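/- arXiv:0911.4649 — 3 statements merged into one kernel-verified Lean document; each statement's English description precedes it below -/
import Mathlib

section
/- Let A be a real symmetric n × n matrix and let 1 ≤ k ≤ n. Then k · σ_k(A) = ∑_{i,j ∈ Fin n} T^{(k−1)}_{ij} A_{ij}, i.e. contracting the (k−1)-st Newton tensor of A against A yields k times the k-th elementary symmetric function of the eigenvalues of A. -/
/-- The generalized Kronecker symbol `δ^{(j_1,…,j_r)}_{(i_1,…,i_r)}`:
the determinant of the `r × r` real matrix whose `(a, b)` entry is `1`
if `i a = j b` and `0` otherwise. -/
noncomputable def gKron {n r : ℕ} (i j : Fin r → Fin n) : ℝ :=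
  Matrix.det (Matrix.of fun a b => if i a = j b then (1 : ℝ) else 0)

/-- The `k`-th elementary symmetric function of the (real) eigenvalues of a
real symmetric (Hermitian) `n × n` matrix `A`. -/
noncomputable def sigmaEig {n : ℕ} (A : Matrix (Fin n) (Fin n) ℝ)
    (hA : A.IsHermitian) (k : ℕ) : ℝ :=
  ∑ t ∈ Finset.univ.powersetCard k, ∏ a ∈ t, hA.eigenvalues a

/-- The `k`-th Newton tensor of `A`:
`T^{(k)}_{ij} := (1/k!) ∑ δ^{(j_1,…,j_k, j)}_{(i_1,…,i_k, i)} A_{i_1 j_1} ⋯ A_{i_k j_k}`. -/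
noncomputable def newton {n : ℕ} (A : Matrix (Fin n) (Fin n) ℝ) (k : ℕ) (i j : Fin n) : ℝ :=
  (1 / (Nat.factorial k : ℝ)) *
    ∑ I : Fin k → Fin n, ∑ J : Fin k → Fin n,
      gKron (Fin.snoc I i) (Fin.snoc J j) * ∏ a : Fin k, A (I a) (J a)

open Polynomial in
lemma aux_minors_comm {n : ℕ} (M N : Matrix (Fin n) (Fin n) ℝ) (k : ℕ) :
    ∑ s ∈ (Finset.univ : Finset (Fin n)).powersetCard k,
      ((M * N).submatrix (Subtype.val : s → Fin n) (Subtype.val : s → Fin n)).det =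
    ∑ s ∈ (Finset.univ : Finset (Fin n)).powersetCard k,
      ((N * M).submatrix (Subtype.val : s → Fin n) (Subtype.val : s → Fin n)).det := by
  rw [← Matrix.coeff_det_one_add_X_smul_eq_sum_minors,
    ← Matrix.coeff_det_one_add_X_smul_eq_sum_minors, Matrix.map_mul, Matrix.map_mul,
    ← Matrix.smul_mul, Matrix.det_one_add_mul_comm, Matrix.mul_smul]

lemma aux_sigma {n : ℕ} (A : Matrix (Fin n) (Fin n) ℝ) (hA : A.IsHermitian) (k : ℕ) :
    sigmaEig A hA k = ∑ s ∈ (Finset.univ : Finset (Fin n)).powersetCard k,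
      (A.submatrix (Subtype.val : s → Fin n) (Subtype.val : s → Fin n)).det := by
  have h := hA.spectral_theorem
  rw [Unitary.conjStarAlgAut_apply] at h
  conv_rhs => rw [h]
  rw [aux_minors_comm, ← mul_assoc, Unitary.coe_star_mul_self, one_mul]
  unfold sigmaEig
  refine Finset.sum_congr rfl fun s _ => ?_
  rw [Matrix.submatrix_diagonal _ _ Subtype.val_injective, Matrix.det_diagonal,
    ← Finset.prod_coe_sort]
  simp

lemma aux_kron {n k : ℕ} (A : Matrix (Fin n) (Fin n) ℝ) (I : Fin k → Fin n) :
    ∑ J : Fin k → Fin n, gKron I J * ∏ a : Fin k, A (I a) (J a) = (A.submatrix I I).det := by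
  rw [← Matrix.det_transpose, Matrix.det_apply']
  simp only [gKron, Matrix.det_apply', Finset.sum_mul]
  rw [Finset.sum_comm]
  refine Finset.sum_congr rfl fun σ _ => ?_
  rw [Finset.sum_eq_single (I ∘ σ)]
  · simp
  · intro J _ hJ
    obtain ⟨b, hb⟩ := Function.ne_iff.1 hJ
    rw [Finset.prod_eq_zero (Finset.mem_univ b)]
    · simp
    · simp only [Matrix.of_apply]
      exact if_neg fun h => hb h.symm
  · simp

lemma aux_count {n k : ℕ} (A : Matrix (Fin n) (Fin n) ℝ) :
    ∑ I : Fin k → Fin n, (A.submatrix I I).det =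
      (k.factorial : ℝ) * ∑ s ∈ (Finset.univ : Finset (Fin n)).powersetCard k,
      (A.submatrix (Subtype.val : s → Fin n) (Subtype.val : s → Fin n)).det := by
  classical
  have h1 : ∑ I : Fin k → Fin n, (A.submatrix I I).det =
      ∑ I ∈ Finset.univ.filter (fun I : Fin k → Fin n => Function.Injective I),
        (A.submatrix I I).det := by
    refine (Finset.sum_filter_of_ne fun I _ h => ?_).symm
    by_contra hI
    obtain ⟨a, b, hab, hne⟩ : ∃ a b, I a = I b ∧ a ≠ b := by
      simpa [Function.Injective] using hI
    exact h (Matrix.det_zero_of_row_eq hne (by ext c; simp [hab]))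
  rw [h1, ← Finset.sum_fiberwise_of_maps_to (g := fun I : Fin k → Fin n => Finset.univ.image I)
    (t := (Finset.univ : Finset (Fin n)).powersetCard k), Finset.mul_sum]
  · refine Finset.sum_congr rfl fun s hs => ?_
    have hc : s.card = k := (Finset.mem_powersetCard.1 hs).2
    have : ∑ e : Fin k ≃ s, (A.submatrix (Subtype.val : s → Fin n) Subtype.val).det =
      ∑ I ∈ (Finset.univ.filter (fun I : Fin k → Fin n => Function.Injective I)).filter
        (fun I => Finset.univ.image I = s), (A.submatrix I I).det := by
      refine Finset.sum_bij (fun e _ => Subtype.val ∘ e) ?_ ?_ ?_ ?_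
      · intro e _
        simp only [Finset.mem_filter, Finset.mem_univ, true_and]
        refine ⟨Subtype.val_injective.comp e.injective, ?_⟩
        ext x
        simp only [Finset.mem_image, Finset.mem_univ, true_and, Function.comp]
        constructor
        · rintro ⟨a, rfl⟩
          exact (e a).2
        · intro hx
          exact ⟨e.symm ⟨x, hx⟩, by simp⟩
      · intro e _ e' _ h
        ext a
        exact congrArg Fin.val (congrFun h a)
      · intro I hI
        simp only [Finset.mem_filter, Finset.mem_univ, true_and] at hI
        obtain ⟨hI, him⟩ := hI
        have hm : ∀ a, I a ∈ s := fun a => him ▸ Finset.mem_image_of_mem I (Finset.mem_univ a)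
        refine ⟨Equiv.ofBijective (fun a => ⟨I a, hm a⟩) ⟨?_, ?_⟩, Finset.mem_univ _, rfl⟩
        · intro a b h
          exact hI (congrArg Subtype.val h)
        · rintro ⟨x, hx⟩
          rw [← him] at hx
          obtain ⟨a, _, ha⟩ := Finset.mem_image.1 hx
          exact ⟨a, Subtype.ext ha⟩
      · intro e _
        rw [← Matrix.det_submatrix_equiv_self e, Matrix.submatrix_submatrix]
    rw [← this, Finset.sum_const, Finset.card_univ,
      Fintype.card_equiv (Fintype.equivOfCardEq (by simp [hc]) : Fin k ≃ s)]
    simp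
  · intro I hI
    simp only [Finset.mem_filter, Finset.mem_univ, true_and] at hI
    simp [Finset.mem_powersetCard, Finset.card_image_of_injective _ hI]

lemma aux_snoc {n k : ℕ} (f : (Fin (k + 1) → Fin n) → ℝ) :
    ∑ I : Fin (k + 1) → Fin n, f I =
      ∑ i : Fin n, ∑ I : Fin k → Fin n, f (Fin.snoc (α := fun _ => Fin n) I i) := by
  rw [← (Fin.snocEquiv (fun _ : Fin (k + 1) => Fin n)).sum_comp, Fintype.sum_prod_type]
  rfl

/-- `k · σ_k(A) = ∑_{i,j} T^{(k−1)}_{ij} A_{ij}`. -/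
theorem newton_contract_self (n k : ℕ) (hk1 : 1 ≤ k) (hk : k ≤ n)
    (A : Matrix (Fin n) (Fin n) ℝ) (hA : A.IsHermitian) :
    (k : ℝ) * sigmaEig A hA k =
      ∑ i : Fin n, ∑ j : Fin n, newton A (k - 1) i j * A i j := by
  obtain ⟨m, rfl⟩ : ∃ m, k = m + 1 := ⟨k - 1, by omega⟩
  rw [Nat.add_sub_cancel]
  have h := aux_count (k := m + 1) A
  rw [← aux_sigma A hA] at h
  simp only [← aux_kron] at h
  rw [aux_snoc] at h
  simp only [aux_snoc (k := m), Fin.prod_univ_castSucc, Fin.snoc_castSucc, Fin.snoc_last] at h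
  have hf : (m.factorial : ℝ) ≠ 0 := by positivity
  have h2 : ∑ i : Fin n, ∑ j : Fin n, newton A m i j * A i j = (1 / (m.factorial : ℝ)) *
      (((m + 1).factorial : ℝ) * sigmaEig A hA (m + 1)) := by
    rw [← h, Finset.mul_sum]
    refine Finset.sum_congr rfl fun i _ => ?_
    rw [Finset.sum_comm, Finset.mul_sum]
    refine Finset.sum_congr rfl fun j _ => ?_
    simp only [newton, Finset.mul_sum, Finset.sum_mul]
    refine Finset.sum_congr rfl fun I _ => Finset.sum_congr rfl fun J _ => ?_
    ring
  rw [h2, Nat.factorial_succ]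
  push_cast
  field_simp
end

section
/- Let A be a real symmetric n × n matrix and let 0 ≤ k ≤ n. Then the trace of the k-th Newton tensor of A equals (n − k) · σ_k(A), i.e. ∑_{i ∈ Fin n} T^{(k)}_{ii} = (n − k) σ_k(A). -/
lemma nt_sumJ {n k : ℕ} (A : Matrix (Fin n) (Fin n) ℝ) (I : Fin k → Fin n) (i : Fin n) :
    ∑ J : Fin k → Fin n, gKron (Fin.snoc I i) (Fin.snoc J i) * ∏ a : Fin k, A (I a) (J a) =
    Matrix.det (Matrix.of fun a b : Fin (k+1) =>
      (Fin.snoc (fun b : Fin k => A (I b) ((Fin.snoc I i : Fin (k+1) → Fin n) a))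
        (if (Fin.snoc I i : Fin (k+1) → Fin n) a = i then (1:ℝ) else 0) : Fin (k+1) → ℝ) b) := by
  unfold gKron
  simp only [Matrix.det_apply', Finset.sum_mul]
  rw [Finset.sum_comm]
  refine Finset.sum_congr rfl fun σ _ => ?_
  simp only [Fin.prod_univ_castSucc, Matrix.of_apply, Fin.snoc_castSucc, Fin.snoc_last]
  have h : ∀ b : Fin k, A (I b) ((Fin.snoc I i : Fin (k+1) → Fin n) (σ b.castSucc)) =
      ∑ j : Fin n, (if (Fin.snoc I i : Fin (k+1) → Fin n) (σ b.castSucc) = j then (1:ℝ) else 0)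
        * A (I b) j := by
    intro b; simp
  simp only [h]
  rw [Finset.prod_univ_sum, Fintype.piFinset_univ, Finset.sum_mul, Finset.mul_sum]
  refine Finset.sum_congr rfl fun J _ => ?_
  rw [Finset.prod_mul_distrib]
  ring

lemma nt_det {n k : ℕ} (A : Matrix (Fin n) (Fin n) ℝ) (I : Fin k → Fin n) (i : Fin n) :
    Matrix.det (Matrix.of fun a b : Fin (k+1) =>
      (Fin.snoc (fun b : Fin k => A (I b) ((Fin.snoc I i : Fin (k+1) → Fin n) a))
        (if (Fin.snoc I i : Fin (k+1) → Fin n) a = i then (1:ℝ) else 0) : Fin (k+1) → ℝ) b) =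
    if i ∈ Set.range I then 0 else (A.submatrix I I).det := by
  split_ifs with h
  · obtain ⟨a, rfl⟩ := h
    apply Matrix.det_zero_of_row_eq (i := a.castSucc) (j := Fin.last k)
    · exact (Fin.castSucc_lt_last a).ne
    · ext b
      simp
  · rw [Matrix.det_succ_column _ (Fin.last k), Finset.sum_eq_single (Fin.last k)]
    · rw [← Matrix.det_transpose (A.submatrix I I)]
      simp [← two_mul]
      congr 1
      ext a b
      simp
    · intro a _ ha
      obtain ⟨a, rfl⟩ := Fin.exists_castSucc_eq.2 ha
      have : I a ≠ i := fun e => h ⟨a, e⟩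
      simp [this]
    · simp

lemma nt_sumi {n k : ℕ} (A : Matrix (Fin n) (Fin n) ℝ) (I : Fin k → Fin n) :
    (∑ i : Fin n, if i ∈ Set.range I then 0 else (A.submatrix I I).det) =
      ((n:ℝ) - k) * (A.submatrix I I).det := by
  classical
  by_cases hI : Function.Injective I
  · have : ∀ i, (if i ∈ Set.range I then 0 else (A.submatrix I I).det) =
      (A.submatrix I I).det - if i ∈ Finset.univ.image I then (A.submatrix I I).det else 0 := by
      intro i
      simp only [Finset.mem_image, Finset.mem_univ, true_and, Set.mem_range]
      split_ifs <;> simp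
    simp only [this, Finset.sum_sub_distrib]
    rw [Finset.sum_ite_mem]
    simp [Finset.card_image_of_injective _ hI, sub_mul]
  · have : (A.submatrix I I).det = 0 := by
      simp only [Function.Injective, not_forall] at hI
      obtain ⟨a, b, h, hab⟩ := hI
      exact Matrix.det_zero_of_row_eq hab (by ext c; simp [h])
    simp [this]

lemma nt_fiber {n k : ℕ} (A : Matrix (Fin n) (Fin n) ℝ) :
    ∑ I : Fin k → Fin n, (A.submatrix I I).det = (k.factorial : ℝ) *
      ∑ s ∈ Finset.univ.powersetCard k,
        (A.submatrix (Subtype.val : s → Fin n) (Subtype.val : s → Fin n)).det := by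
  classical
  have h0 : ∑ I : Fin k → Fin n, (A.submatrix I I).det =
      ∑ I : Fin k → Fin n with Function.Injective I, (A.submatrix I I).det := by
    symm
    apply Finset.sum_subset (Finset.subset_univ _)
    intro I _ hI
    simp only [Finset.mem_filter, Finset.mem_univ, true_and] at hI
    simp only [Function.Injective, not_forall] at hI
    obtain ⟨a, b, h, hab⟩ := hI
    exact Matrix.det_zero_of_row_eq hab (by ext c; simp [h])
  rw [h0, ← Finset.sum_fiberwise_of_maps_to (g := fun I => Finset.univ.image I)
    (t := Finset.univ.powersetCard k), Finset.mul_sum]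
  · refine Finset.sum_congr rfl fun s hs => ?_
    have hc : s.card = k := (Finset.mem_powersetCard.1 hs).2
    have e0 : Fin k ≃ s := (finCongr hc.symm).trans s.equivFin.symm
    have hcard : (k.factorial : ℝ) = ((Finset.univ : Finset (Fin k ≃ s)).card : ℝ) := by
      rw [Finset.card_univ, Fintype.card_equiv e0, Fintype.card_fin]
    rw [hcard, ← nsmul_eq_mul, ← Finset.sum_const]
    symm
    refine Finset.sum_bij (fun e _ => fun a => (e a : Fin n)) ?_ ?_ ?_ ?_
    · intro e _
      simp only [Finset.mem_filter, Finset.mem_univ, true_and]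
      refine ⟨Subtype.val_injective.comp e.injective, ?_⟩
      ext x
      simp only [Finset.mem_image, Finset.mem_univ, true_and]
      constructor
      · rintro ⟨a, rfl⟩; exact (e a).2
      · intro hx; exact ⟨e.symm ⟨x, hx⟩, by simp⟩
    · intro e _ f _ h
      ext a
      exact congrArg Fin.val (congrFun h a)
    · intro I hI
      simp only [Finset.mem_filter, Finset.mem_univ, true_and] at hI
      obtain ⟨hI, rfl⟩ := hI
      refine ⟨Equiv.ofBijective (fun a => ⟨I a, Finset.mem_image_of_mem _ (Finset.mem_univ a)⟩)
        ⟨fun a b h => hI (congrArg Subtype.val h), ?_⟩, Finset.mem_univ _, ?_⟩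
      · rintro ⟨x, hx⟩
        obtain ⟨a, _, rfl⟩ := Finset.mem_image.1 hx
        exact ⟨a, rfl⟩
      · ext a; rfl
    · intro e _
      exact (Matrix.det_submatrix_equiv_self e _).symm
  · intro I hI
    simp only [Finset.mem_filter, Finset.mem_univ, true_and] at hI
    simp [Finset.mem_powersetCard, Finset.card_image_of_injective _ hI]

lemma nt_sigma {n k : ℕ} (hk : k ≤ n) (A : Matrix (Fin n) (Fin n) ℝ) (hA : A.IsHermitian) :
    ∑ s ∈ Finset.univ.powersetCard k,
        (A.submatrix (Subtype.val : s → Fin n) (Subtype.val : s → Fin n)).det =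
      sigmaEig A hA k := by
  have h1 := Matrix.charpoly_coeff_eq_sum_minors A k (by simpa using hk)
  have h2 := Matrix.charpoly_coeff_eq_sum_minors (Matrix.diagonal hA.eigenvalues) k
    (by simpa using hk)
  have h3 : A.charpoly = (Matrix.diagonal hA.eigenvalues).charpoly := by
    rw [hA.charpoly_eq, Matrix.charpoly_diagonal]
    simp
  rw [h3, h2] at h1
  have h4 := mul_left_cancel₀ (pow_ne_zero k (by norm_num : (-1:ℝ) ≠ 0)) h1
  rw [← h4]
  unfold sigmaEig
  refine Finset.sum_congr rfl fun s _ => ?_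
  rw [Matrix.submatrix_diagonal _ _ Subtype.val_injective, Matrix.det_diagonal]
  exact (Finset.prod_coe_sort s hA.eigenvalues)

/-- `∑_i T^{(k)}_{ii} = (n − k) σ_k(A)`. -/
theorem newton_trace (n k : ℕ) (hk : k ≤ n)
    (A : Matrix (Fin n) (Fin n) ℝ) (hA : A.IsHermitian) :
    ∑ i : Fin n, newton A k i i = ((n : ℝ) - k) * sigmaEig A hA k := by
  classical
  unfold newton
  rw [← Finset.mul_sum, Finset.sum_comm]
  simp only [nt_sumJ, nt_det, nt_sumi]
  rw [← Finset.mul_sum, nt_fiber, nt_sigma hk A hA]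
  have : (k.factorial : ℝ) ≠ 0 := by positivity
  field_simp
end

section
/- Let n, r be natural numbers with r ≥ 1 and 2r ≤ n, let α be a real symmetric n × n matrix, and let F : (Fin (2r−2) → Fin n) → (Fin (2r−2) → Fin n) → ℝ be an arbitrary family of real numbers indexed by pairs of (2r−2)-tuples of indices. Define P^{j}_{i} := ∑_{I, J} δ^{(j, J)}_{(i, I)} F(I, J), the sum running over all index tuples I, J : Fin (2r−2) → Fin n. Then ∑ δ^{(j_1, j_2, J)}_{(i_1, i_2, I)} (α ⊙ δ)^{i_1 i_2}_{j_1 j_2} F(I, J) = 4 (n − 2r + 1) ∑_{i, j ∈ Fin n} P^{j}_{i} α_{ij}, the sum on the left running over all i_1, i_2, j_1, j_2 ∈ Fin n and all index tuples I, J : Fin (2r−2) → Fin n. -/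
/-- The Kronecker delta `δ_{xy}`. -/
def kdelta {n : ℕ} (x y : Fin n) : ℝ := if x = y then 1 else 0

/-- The Kulkarni–Nomizu product of `α` with the identity:
`(α ⊙ δ)^{ab}_{cd} := α_{ac} δ_{bd} + α_{bd} δ_{ac} − α_{ad} δ_{bc} − α_{bc} δ_{ad}`. -/
def KN {n : ℕ} (α : Matrix (Fin n) (Fin n) ℝ) (a b c d : Fin n) : ℝ :=
  α a c * kdelta b d + α b d * kdelta a c - α a d * kdelta b c - α b c * kdelta a d

theorem gKron_comp_left {n r : ℕ} (i j : Fin r → Fin n) (σ : Equiv.Perm (Fin r)) :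
    gKron (i ∘ σ) j = (Equiv.Perm.sign σ : ℝ) * gKron i j := by
  unfold gKron
  rw [← Matrix.det_permute]
  rfl

theorem gKron_comp_right {n r : ℕ} (i j : Fin r → Fin n) (σ : Equiv.Perm (Fin r)) :
    gKron i (j ∘ σ) = (Equiv.Perm.sign σ : ℝ) * gKron i j := by
  unfold gKron
  rw [← Matrix.det_permute']
  rfl

theorem cons_swap {n m : ℕ} (a b : Fin n) (I : Fin m → Fin n) :
    (Fin.cons b (Fin.cons a I) : Fin (m + 2) → Fin n) =
      (Fin.cons a (Fin.cons b I) : Fin (m + 2) → Fin n) ∘ (Equiv.swap 0 1) := by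
  funext x
  refine Fin.cases ?_ (fun x => ?_) x
  · simp [Equiv.swap_apply_left]
  · refine Fin.cases ?_ (fun y => ?_) x
    · simp [Equiv.swap_apply_right]
    · rw [Function.comp_apply, Equiv.swap_apply_of_ne_of_ne]
      · rfl
      · exact Fin.succ_ne_zero _
      · intro h
        exact Fin.succ_ne_zero y (Fin.succ_injective _ h)

theorem gKron_swap_left {n m : ℕ} (a b : Fin n) (I : Fin m → Fin n) (j : Fin (m + 2) → Fin n) :
    gKron (Fin.cons b (Fin.cons a I)) j = - gKron (Fin.cons a (Fin.cons b I)) j := by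
  rw [cons_swap, gKron_comp_left, Equiv.Perm.sign_swap (by simp)]
  simp

theorem gKron_swap_right {n m : ℕ} (a b : Fin n) (I : Fin m → Fin n) (j : Fin (m + 2) → Fin n) :
    gKron j (Fin.cons b (Fin.cons a I)) = - gKron j (Fin.cons a (Fin.cons b I)) := by
  rw [cons_swap, gKron_comp_right, Equiv.Perm.sign_swap (by simp)]
  simp

theorem cons_cycle {n m : ℕ} (J : Fin m → Fin n) (c : Fin m) (x : Fin m) :
    (Fin.cons (J c) J : Fin (m + 1) → Fin n) (c.succ.succAbove (c.cycleRange x)) = J x := by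
  rw [Fin.succAbove_cycleRange]
  by_cases h : x = c
  · subst h
    simp
  · rw [Equiv.swap_apply_of_ne_of_ne (Fin.succ_ne_zero _) (fun e => h (Fin.succ_injective _ e))]
    simp

theorem gKron_minor {n m : ℕ} (I J : Fin m → Fin n) (c : Fin m) :
    gKron I ((Fin.cons (J c) J : Fin (m + 1) → Fin n) ∘ c.succ.succAbove)
      = (-1) ^ (c : ℕ) * gKron I J := by
  have h : gKron I (((Fin.cons (J c) J : Fin (m + 1) → Fin n) ∘ c.succ.succAbove) ∘ c.cycleRange)
      = gKron I J := by
    congr 1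
    funext x
    exact cons_cycle J c x
  rw [gKron_comp_right, Fin.sign_cycleRange] at h
  rw [← h, ← mul_assoc]
  push_cast
  rw [← mul_pow]
  simp

theorem gKron_contract {n m : ℕ} (I J : Fin m → Fin n) :
    ∑ k : Fin n, gKron (Fin.cons k I : Fin (m + 1) → Fin n) (Fin.cons k J)
      = ((n : ℝ) - m) * gKron I J := by
  have h1 : ∀ k : Fin n, gKron (Fin.cons k I : Fin (m + 1) → Fin n) (Fin.cons k J)
      = gKron I J + ∑ c : Fin m, (-1) ^ ((c : ℕ) + 1) * (if k = J c then (1 : ℝ) else 0) *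
          gKron I ((Fin.cons k J : Fin (m + 1) → Fin n) ∘ c.succ.succAbove) := by
    intro k
    conv_lhs => unfold gKron
    rw [Matrix.det_succ_row_zero, Fin.sum_univ_succ]
    congr 1
    simp [gKron]
    rfl
  simp_rw [h1]
  rw [Finset.sum_add_distrib, Finset.sum_comm]
  have h2 : ∀ c : Fin m, ∑ k : Fin n, (-1) ^ ((c : ℕ) + 1) * (if k = J c then (1 : ℝ) else 0) *
          gKron I ((Fin.cons k J : Fin (m + 1) → Fin n) ∘ c.succ.succAbove) = - gKron I J := by
    intro c
    rw [Finset.sum_eq_single (J c)]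
    · rw [gKron_minor, if_pos rfl, mul_one, ← mul_assoc, ← pow_add,
        Odd.neg_one_pow ⟨c, by ring⟩]
      ring
    · intro b _ hb
      simp [hb]
    · simp
  simp_rw [h2]
  simp
  ring

theorem kn_abstract {n : ℕ} (α : Matrix (Fin n) (Fin n) ℝ) (G : Fin n → Fin n → Fin n → Fin n → ℝ)
    (H : Fin n → Fin n → ℝ) (c : ℝ)
    (hl : ∀ a b x y, G b a x y = - G a b x y) (hr : ∀ a b x y, G a b y x = - G a b x y)
    (hc : ∀ i j, ∑ k, G k i k j = c * H i j) :
    ∑ a, ∑ b, ∑ x, ∑ y, G a b x y * KN α a b x y = 4 * c * ∑ i, ∑ j, H i j * α i j := by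
  have hc2 : ∀ i j, ∑ k, G i k j k = c * H i j := by
    intro i j
    rw [← hc]
    refine Finset.sum_congr rfl fun k _ => ?_
    rw [hl k i, hr k i k j]
    rw [hl, hr]
    try ring
  have hc3 : ∀ i j, ∑ k, G i k k j = - (c * H i j) := by
    intro i j
    rw [← hc, ← Finset.sum_neg_distrib]
    exact Finset.sum_congr rfl fun k _ => hl k i k j
  have hc4 : ∀ i j, ∑ k, G k i j k = - (c * H i j) := by
    intro i j
    rw [← hc, ← Finset.sum_neg_distrib]
    exact Finset.sum_congr rfl fun k _ => hr k i k j
  have e1 : ∑ a, ∑ b, ∑ x, ∑ y, G a b x y * (α a x * kdelta b y) = c * ∑ i, ∑ j, H i j * α i j := by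
    simp only [kdelta, mul_ite, mul_one, mul_zero, Finset.sum_ite_eq, Finset.mem_univ, if_true,
      Finset.mul_sum]
    refine Finset.sum_congr rfl fun a _ => ?_
    rw [Finset.sum_comm]
    refine Finset.sum_congr rfl fun x _ => ?_
    rw [← Finset.sum_mul, hc2]
    ring
  have e2 : ∑ a, ∑ b, ∑ x, ∑ y, G a b x y * (α b y * kdelta a x) = c * ∑ i, ∑ j, H i j * α i j := by
    rw [Finset.sum_comm, Finset.mul_sum]
    refine Finset.sum_congr rfl fun b _ => ?_
    rw [Finset.mul_sum]
    have : ∀ a, ∑ x, ∑ y, G a b x y * (α b y * kdelta a x) = ∑ y, G a b a y * α b y := by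
      intro a
      rw [Finset.sum_comm]
      simp [kdelta]
    simp_rw [this]
    rw [Finset.sum_comm]
    refine Finset.sum_congr rfl fun x _ => ?_
    rw [← Finset.sum_mul, hc]
    ring
  have e3 : ∑ a, ∑ b, ∑ x, ∑ y, G a b x y * (α a y * kdelta b x) =
      - (c * ∑ i, ∑ j, H i j * α i j) := by
    rw [Finset.mul_sum, ← Finset.sum_neg_distrib]
    refine Finset.sum_congr rfl fun a _ => ?_
    rw [Finset.mul_sum, ← Finset.sum_neg_distrib]
    have : ∀ b, ∑ x, ∑ y, G a b x y * (α a y * kdelta b x) = ∑ y, G a b b y * α a y := by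
      intro b
      rw [Finset.sum_comm]
      simp [kdelta]
    simp_rw [this]
    rw [Finset.sum_comm]
    refine Finset.sum_congr rfl fun x _ => ?_
    rw [← Finset.sum_mul, hc3]
    ring
  have e4 : ∑ a, ∑ b, ∑ x, ∑ y, G a b x y * (α b x * kdelta a y) =
      - (c * ∑ i, ∑ j, H i j * α i j) := by
    rw [Finset.sum_comm, Finset.mul_sum, ← Finset.sum_neg_distrib]
    refine Finset.sum_congr rfl fun b _ => ?_
    rw [Finset.mul_sum, ← Finset.sum_neg_distrib]
    simp only [kdelta, mul_ite, mul_one, mul_zero, Finset.sum_ite_eq, Finset.mem_univ, if_true]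
    rw [Finset.sum_comm]
    refine Finset.sum_congr rfl fun x _ => ?_
    rw [← Finset.sum_mul, hc4]
    ring
  simp only [KN, mul_sub, mul_add, Finset.sum_sub_distrib, Finset.sum_add_distrib]
  rw [e1, e2, e3, e4]
  ring

theorem kn_aux {n m : ℕ} (α : Matrix (Fin n) (Fin n) ℝ) (c : ℝ) (hcm : c = (n : ℝ) - (m + 1 : ℕ))
    (F : (Fin m → Fin n) → (Fin m → Fin n) → ℝ) :
    ∑ i₁ : Fin n, ∑ i₂ : Fin n, ∑ j₁ : Fin n, ∑ j₂ : Fin n,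
        ∑ I : Fin m → Fin n, ∑ J : Fin m → Fin n,
          gKron (Fin.cons i₁ (Fin.cons i₂ I) : Fin (m + 2) → Fin n) (Fin.cons j₁ (Fin.cons j₂ J)) *
            KN α i₁ i₂ j₁ j₂ * F I J
      = 4 * c *
          ∑ i : Fin n, ∑ j : Fin n,
            (∑ I : Fin m → Fin n, ∑ J : Fin m → Fin n,
              gKron (Fin.cons i I : Fin (m + 1) → Fin n) (Fin.cons j J) * F I J) * α i j := by
  rw [← kn_abstract α (fun a b x y => ∑ I : Fin m → Fin n, ∑ J : Fin m → Fin n,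
    gKron (Fin.cons a (Fin.cons b I) : Fin (m + 2) → Fin n) (Fin.cons x (Fin.cons y J)) * F I J)]
  · simp_rw [Finset.sum_mul, mul_right_comm]
  · intro a b x y
    simp_rw [← Finset.sum_neg_distrib]
    refine Finset.sum_congr rfl fun I _ => Finset.sum_congr rfl fun J _ => ?_
    rw [gKron_swap_left, neg_mul]
  · intro a b x y
    simp_rw [← Finset.sum_neg_distrib]
    refine Finset.sum_congr rfl fun I _ => Finset.sum_congr rfl fun J _ => ?_
    rw [gKron_swap_right, neg_mul]
  · intro i j
    rw [Finset.sum_comm, Finset.mul_sum]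
    refine Finset.sum_congr rfl fun I _ => ?_
    rw [Finset.sum_comm, Finset.mul_sum]
    refine Finset.sum_congr rfl fun J _ => ?_
    rw [← Finset.sum_mul, gKron_contract, hcm, mul_assoc]

/-- Contracting the Kulkarni–Nomizu product `α ⊙ δ` into two prepended slots of the
generalized Kronecker symbol yields `4(n − 2r + 1)` times the contraction of
`P^j_i := ∑ δ^{(j,J)}_{(i,I)} F(I,J)` against `α`. -/
theorem kn_contraction (n r : ℕ) (hr : 1 ≤ r) (hrn : 2 * r ≤ n)
    (α : Matrix (Fin n) (Fin n) ℝ) (hα : α.IsSymm)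
    (F : (Fin (2 * r - 2) → Fin n) → (Fin (2 * r - 2) → Fin n) → ℝ) :
    ∑ i₁ : Fin n, ∑ i₂ : Fin n, ∑ j₁ : Fin n, ∑ j₂ : Fin n,
        ∑ I : Fin (2 * r - 2) → Fin n, ∑ J : Fin (2 * r - 2) → Fin n,
          gKron (Fin.cons i₁ (Fin.cons i₂ I)) (Fin.cons j₁ (Fin.cons j₂ J)) *
            KN α i₁ i₂ j₁ j₂ * F I J
      = 4 * ((n : ℝ) - 2 * r + 1) *
          ∑ i : Fin n, ∑ j : Fin n,
            (∑ I : Fin (2 * r - 2) → Fin n, ∑ J : Fin (2 * r - 2) → Fin n,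
              gKron (Fin.cons i I) (Fin.cons j J) * F I J) * α i j := by
  refine kn_aux (m := 2 * r - 2) α _ ?_ F
  have h : 2 * r - 2 + 1 + 1 = 2 * r := by omega
  have h' : (((2 * r - 2 + 1 : ℕ) : ℝ)) + 1 = 2 * r := by exact_mod_cast h
  linarith
end
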